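/- Let M = (S, A, s0, P) be a reward-free MDP with finite state space S satisfying the RESET assumption and let L ≥ 1 be a real number. Then S→_L is a fixed point of the state-expansion operator: T_L(S→_L) = S→_L. -/

import Mathlib

open scoped ENNReal Classical

/-- A reward-free MDP with countable state space `S`, action space `A` containing a
distinguished `RESET` action, initial state `s0`, and transition kernel `P`,
satisfying the RESET assumption. -/
structure RFMDP (S : Type) (A : Type) where
  s0 : S
  reset : A
  P : S → A → PMF S
  reset_eq : ∀ s : S, P s reset s0 = 1

namespace RFMDP

variable {S A : Type}

/-- `survive M π g n s` is the probability that the Markov chain started at `s` and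
following policy `π` has not yet hit the goal `g` within the first `n+1` visited states,
i.e. `P(T > n)` where `T = inf {i ≥ 0 : s_{i+1} = g}` and `s_1 = s`. -/
noncomputable def survive (M : RFMDP S A) (π : S → A) (g : S) : ℕ → S → ℝ≥0∞
  | 0, s => if s = g then 0 else 1
  | n + 1, s => if s = g then 0 else ∑' s' : S, M.P s (π s) s' * survive M π g n s'

/-- The value `V^π_g(s)`: the expected hitting time of the goal `g` starting from `s`
and following policy `π` (`+∞` if `g` is almost surely unreachable), computed as
`E[T] = Σ_{n ≥ 0} P(T > n)`. -/
noncomputable def V (M : RFMDP S A) (π : S → A) (g s : S) : ℝ≥0∞ :=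
  ∑' n : ℕ, M.survive π g n s

/-- The set `Π(X)` of policies restricted on `X`: those playing `RESET` outside `X`. -/
def restrictedPolicies (M : RFMDP S A) (X : Set S) : Set (S → A) :=
  {π | ∀ s ∉ X, π s = M.reset}

/-- `V*_{X,g}(s)`: the optimal hitting time of `g` from `s` over policies restricted on `X`. -/
noncomputable def Vstar (M : RFMDP S A) (X : Set S) (g s : S) : ℝ≥0∞ :=
  ⨅ π ∈ M.restrictedPolicies X, M.V π g s

/-- The state-expansion operator `T_L`. -/
def TL (M : RFMDP S A) (L : ℝ) (X : Set S) : Set S :=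
  {s | M.Vstar X s M.s0 ≤ ENNReal.ofReal L}

/-- `S_L^≺`: the least subset of `S` containing `s0` and closed under adding any state `s`
reachable in at most `L` expected steps from `s0` by a policy restricted on
`{s' ∈ S_L^≺ : s' ≺ s}`. -/
def SLprec (M : RFMDP S A) (L : ℝ) (prec : S → S → Prop) : Set S :=
  sInf {X : Set S | M.s0 ∈ X ∧
    ∀ s : S, (∃ π ∈ M.restrictedPolicies {s' ∈ X | prec s' s},
      M.V π s M.s0 ≤ ENNReal.ofReal L) → s ∈ X}

/-- The set `S→_L` of incrementally `L`-controllable states: the union of `S_L^≺` over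
all (strict) partial orders `≺` on `S`. -/
def SLarrow (M : RFMDP S A) (L : ℝ) : Set S :=
  ⋃ (prec : S → S → Prop) (_ : IsStrictOrder S prec), M.SLprec L prec

/-- The layer sequence: `layer 0 = {s0} = K*_1` and `layer (n+1) = T_L (layer n) = K*_{n+2}`. -/
noncomputable def layer (M : RFMDP S A) (L : ℝ) : ℕ → Set S
  | 0 => {M.s0}
  | n + 1 => M.TL L (M.layer L n)

end RFMDP

namespace RFMDP

lemma restrictedPolicies_mono {S A : Type} (M : RFMDP S A) {X Y : Set S} (h : X ⊆ Y) :
    M.restrictedPolicies X ⊆ M.restrictedPolicies Y :=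
  fun _ hπ s hs => hπ s fun hX => hs (h hX)

lemma TL_mono {S A : Type} (M : RFMDP S A) (L : ℝ) : Monotone (M.TL L) := fun _ _ h _ hs =>
  le_trans (biInf_mono fun _ hπ => M.restrictedPolicies_mono h hπ) (Set.mem_ofPred.1 hs)

lemma V_self {S A : Type} (M : RFMDP S A) (π : S → A) (s : S) : M.V π s s = 0 :=
  ENNReal.tsum_eq_zero.2 fun n => by cases n <;> simp [survive]

lemma s0_mem_TL {S A : Type} (M : RFMDP S A) (L : ℝ) (X : Set S) : M.s0 ∈ M.TL L X := by
  have hle : M.Vstar X M.s0 M.s0 ≤ M.V (fun _ => M.reset) M.s0 M.s0 :=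
    iInf₂_le _ fun _ _ => rfl
  exact hle.trans ((M.V_self _ _).trans_le zero_le)

/-- For finite state and action spaces, the infimum defining `V*` is attained. -/
lemma mem_TL_iff {S A : Type} [Finite S] [Finite A] (M : RFMDP S A) (L : ℝ) (X : Set S) (s : S) :
    s ∈ M.TL L X ↔ ∃ π ∈ M.restrictedPolicies X, M.V π s M.s0 ≤ ENNReal.ofReal L := by
  constructor
  · intro hs
    obtain ⟨π, hπ, hmin⟩ := Set.exists_min_image (M.restrictedPolicies X)
      (fun π => M.V π s M.s0) (Set.toFinite _) ⟨fun _ => M.reset, fun _ _ => rfl⟩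
    exact ⟨π, hπ, (le_iInf₂ hmin).trans hs⟩
  · rintro ⟨π, hπ, h⟩
    have hle : M.Vstar X s M.s0 ≤ M.V π s M.s0 := iInf₂_le π hπ
    exact hle.trans h

lemma layer_mono {S A : Type} (M : RFMDP S A) (L : ℝ) : Monotone (M.layer L) := by
  refine monotone_nat_of_le_succ fun n => ?_
  induction n with
  | zero => exact Set.singleton_subset_iff.2 (M.s0_mem_TL L _)
  | succ n ih => exact M.TL_mono L ih

/-- The strict order comparing states by the first layer containing them. -/
lemma isStrictOrder_layer {S A : Type} (M : RFMDP S A) (L : ℝ) :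
    IsStrictOrder S fun a b => ∃ n, a ∈ M.layer L n ∧ b ∉ M.layer L n where
  irrefl := fun _ ⟨_, h, h'⟩ => h' h
  trans := by
    rintro a b c ⟨n, ha, hb⟩ ⟨m, hb', hc⟩
    have hnm : n ≤ m := le_of_not_ge fun h => hb (M.layer_mono L h hb')
    exact ⟨m, M.layer_mono L hnm ha, hc⟩

lemma layer_subset_SLprec {S A : Type} [Finite S] [Finite A] (M : RFMDP S A) (L : ℝ) (n : ℕ) :
    M.layer L n ⊆ M.SLprec L fun a b => ∃ n, a ∈ M.layer L n ∧ b ∉ M.layer L n := by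
  rintro s hs X ⟨h0, hX⟩
  induction n generalizing s with
  | zero => exact (Set.mem_singleton_iff.1 hs) ▸ h0
  | succ n ih =>
    by_cases hn : s ∈ M.layer L n
    · exact ih hn
    · obtain ⟨π, hπ, h⟩ := (M.mem_TL_iff L _ s).1 hs
      refine hX s ⟨π, M.restrictedPolicies_mono ?_ hπ, h⟩
      exact fun t ht => ⟨ih ht, n, ht, hn⟩

lemma SLprec_subset_of_TL_subset {S A : Type} [Finite S] [Finite A] (M : RFMDP S A) (L : ℝ)
    (prec : S → S → Prop) {X : Set S} (hX : M.TL L X ⊆ X) : M.SLprec L prec ⊆ X := by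
  refine sInf_le ⟨hX (M.s0_mem_TL L X), ?_⟩
  rintro t ⟨π, hπ, h⟩
  exact hX ((M.mem_TL_iff L X t).2 ⟨π, M.restrictedPolicies_mono (fun _ ht => ht.1) hπ, h⟩)

end RFMDP

/-- for a finite-state MDP, `S→_L` is a fixed point of `T_L`. -/
theorem TL_SLarrow_eq
    {S A : Type} [Finite S] [Finite A] (M : RFMDP S A) (L : ℝ) (hL : 1 ≤ L) :
    M.TL L (M.SLarrow L) = M.SLarrow L := by
  obtain ⟨n, hn⟩ := WellFoundedGT.monotone_chain_condition ⟨M.layer L, M.layer_mono L⟩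
  have hfix : M.TL L (M.layer L n) = M.layer L n := (hn (n + 1) n.le_succ).symm
  have heq : M.SLarrow L = M.layer L n :=
    (Set.iUnion₂_subset fun prec _ => M.SLprec_subset_of_TL_subset L prec hfix.subset).antisymm
      ((M.layer_subset_SLprec L n).trans
        (Set.subset_iUnion₂_of_subset _ (M.isStrictOrder_layer L) subset_rfl))
  rw [heq, hfix]
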